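/- Let m ≥ 1, let d : Fin m → ℕ, and let X = Π_{i ∈ Fin m} ℝ^{d(i)} be the product of Euclidean spaces. Let F : X → ℝ be continuously differentiable with F ≥ 0, and let c > 0. Let (x_k)_{k≥0} be a sequence in X such that: (i) for each k, x_{k+1} differs from x_k only in the block i_k := k mod m; (ii) x_{k+1} exactly minimizes F over that block, i.e., F(x_{k+1}) ≤ F(update of x_k at block i_k to y) for every y ∈ ℝ^{d(i_k)}; and (iii) the sufficient decrease F(x_{k+1}) ≤ F(x_k) − c·‖x_{k+1} − x_k‖² holds. If x* is the limit of a convergent subsequence of (x_k), then x* is block-coordinate stationary: for every block i, the function y ↦ F(update of x* at block i to y) has vanishing derivative at y = x*_i. -/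

import Mathlib

open Filter

/-- A sequence with sufficient decrease of a nonnegative objective has vanishing increments. -/
theorem tendsto_increment_of_sufficient_decrease {E : Type*} [NormedAddCommGroup E]
    {F : E → ℝ} (hF : ∀ x, 0 ≤ F x) {c : ℝ} (hc : 0 < c) {x : ℕ → E}
    (hdec : ∀ k, F (x (k + 1)) ≤ F (x k) - c * ‖x (k + 1) - x k‖ ^ 2) :
    Tendsto (fun k => x (k + 1) - x k) atTop (nhds 0) := by
  have hanti : Antitone fun k => F (x k) :=
    antitone_nat_of_succ_le fun k => (hdec k).trans (sub_le_self _ (by positivity))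
  have hconv := tendsto_atTop_ciInf hanti ⟨0, by rintro _ ⟨k, rfl⟩; exact hF _⟩
  have hdiff : Tendsto (fun k => (F (x k) - F (x (k + 1))) / c) atTop (nhds 0) := by
    simpa using (hconv.sub (hconv.comp (tendsto_add_atTop_nat 1))).div_const c
  have hsq : Tendsto (fun k => ‖x (k + 1) - x k‖ ^ 2) atTop (nhds 0) := by
    refine squeeze_zero (fun k => by positivity) (fun k => ?_) hdiff
    rw [le_div_iff₀ hc]
    linarith [hdec k]
  rw [tendsto_zero_iff_norm_tendsto_zero]
  simpa using hsq.sqrt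

/-- If the increments of `x` vanish, the limit of a subsequence is unaffected by bounded shifts
of its indices. -/
theorem tendsto_comp_add_of_tendsto_increment {E : Type*} [NormedAddCommGroup E]
    {x : ℕ → E} (hx : Tendsto (fun k => x (k + 1) - x k) atTop (nhds 0))
    {φ : ℕ → ℕ} (hφ : Tendsto φ atTop atTop) {a : E} (hlim : Tendsto (x ∘ φ) atTop (nhds a))
    {s : ℕ → ℕ} {m : ℕ} (hs : ∀ n, s n ≤ m) :
    Tendsto (fun n => x (φ n + s n)) atTop (nhds a) := by
  have hshift (t : ℕ) : Tendsto (fun n => x (φ n + t)) atTop (nhds a) := by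
    induction t with
    | zero => exact hlim
    | succ t ih =>
      have hinc := hx.comp ((tendsto_add_atTop_nat t).comp hφ)
      simpa [Function.comp_def, ← add_assoc] using ih.add hinc
  intro U hU
  have hev : ∀ᶠ n in atTop, ∀ t ∈ Finset.range (m + 1), x (φ n + t) ∈ U :=
    (eventually_all_finset _).2 fun t _ => hshift t hU
  exact hev.mono fun n hn => hn _ (Finset.mem_range.2 (Nat.lt_succ_of_le (hs n)))

/-- Monotone descent of cyclic exact block-coordinate minimization: if each step updates
only the block `k % m`, exactly minimizes the continuously differentiable objective `F ≥ 0`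
over that block, and produces a sufficient decrease, then every limit point of the iterate
sequence is block-coordinate stationary. -/
theorem block_coordinate_limit_point_stationary
    (m : ℕ) (hm : 1 ≤ m) (d : Fin m → ℕ)
    (F : (∀ i : Fin m, EuclideanSpace ℝ (Fin (d i))) → ℝ)
    (hF_smooth : ContDiff ℝ 1 F) (hF_nonneg : ∀ x, 0 ≤ F x)
    (c : ℝ) (hc : 0 < c)
    (x : ℕ → ∀ i : Fin m, EuclideanSpace ℝ (Fin (d i)))
    (hblock : ∀ k : ℕ, ∀ j : Fin m, j ≠ ⟨k % m, Nat.mod_lt k hm⟩ → x (k + 1) j = x k j)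
    (hmin : ∀ k : ℕ, ∀ y : EuclideanSpace ℝ (Fin (d ⟨k % m, Nat.mod_lt k hm⟩)),
      F (x (k + 1)) ≤ F (Function.update (x k) ⟨k % m, Nat.mod_lt k hm⟩ y))
    (hdec : ∀ k : ℕ, F (x (k + 1)) ≤ F (x k) - c * ‖x (k + 1) - x k‖ ^ 2)
    (xstar : ∀ i : Fin m, EuclideanSpace ℝ (Fin (d i)))
    (φ : ℕ → ℕ) (hφ : StrictMono φ)
    (hlim : Tendsto (x ∘ φ) atTop (nhds xstar)) :
    ∀ i : Fin m,
      fderiv ℝ (fun y : EuclideanSpace ℝ (Fin (d i)) => F (Function.update xstar i y))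
        (xstar i) = 0 := by
  intro i
  have hshift (n : ℕ) : ∃ t ≤ m, (φ n + t) % m = i := by
    refine ⟨(i + (m - φ n % m)) % m, (Nat.mod_lt _ hm).le, ?_⟩
    have hlt := Nat.mod_lt (φ n) hm
    rw [Nat.add_mod_mod, Nat.add_mod, ← Nat.mod_mod (φ n), ← Nat.add_mod, Nat.mod_mod,
      show φ n % m + (i + (m - φ n % m)) = i + m by omega, Nat.add_mod_right,
      Nat.mod_eq_of_lt i.isLt]
  choose s hs hmod using hshift
  have htend : Tendsto (fun n => x (φ n + (s n + 1))) atTop (nhds xstar) :=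
    tendsto_comp_add_of_tendsto_increment
      (tendsto_increment_of_sufficient_decrease hF_nonneg hc hdec) hφ.tendsto_atTop hlim
      fun n => Nat.succ_le_succ (hs n)
  have hle (y : EuclideanSpace ℝ (Fin (d i))) : F xstar ≤ F (Function.update xstar i y) := by
    refine le_of_tendsto_of_tendsto' ((hF_smooth.continuous.tendsto _).comp htend)
      ((hF_smooth.continuous.tendsto _).comp (htend.update i tendsto_const_nhds)) fun n => ?_
    obtain rfl : (⟨(φ n + s n) % m, Nat.mod_lt _ hm⟩ : Fin m) = i := Fin.ext (hmod n)
    refine (hmin (φ n + s n) y).trans_eq (congrArg F (funext fun j => ?_))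
    by_cases hj : j = ⟨(φ n + s n) % m, Nat.mod_lt _ hm⟩
    · subst hj
      simp
    · simpa [Function.update_of_ne hj, ← add_assoc] using (hblock _ j hj).symm
  refine IsLocalMin.fderiv_eq_zero (Eventually.of_forall fun y => ?_)
  simpa using hle y
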